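/- Let κ be a finite nonnegative Borel measure on ℝ. Suppose there exist exponents 0 < α < a < 1, an integer n ≥ 1 with n > a, and a constant C > 0 such that for every bounded α-Hölder continuous function φ : ℝ → ℝ and every h ∈ ℝ with |h| ≤ 1, one has |∫_ℝ (Δ_h^n φ)(y) κ(dy)| ≤ C ‖φ‖_{C^α_b} |h|^a. Then κ is absolutely continuous with respect to the Lebesgue measure on ℝ. -/

import Mathlib

open MeasureTheory

/-- n-th order finite difference: `(Δ_h^n φ)(x) = ∑_{j=0}^n (-1)^{n-j} (n choose j) φ(x + j h)`. -/
noncomputable def fdiff (n : ℕ) (h : ℝ) (φ : ℝ → ℝ) (x : ℝ) : ℝ :=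
  ∑ j ∈ Finset.range (n + 1), (-1 : ℝ) ^ (n - j) * (n.choose j : ℝ) * φ (x + (j : ℝ) * h)

noncomputable def AA (u : ℝ) (ψ : ℝ → ℝ) (x : ℝ) : ℝ := ∫ t in (0:ℝ)..1, ψ (x + u * t)

noncomputable def cc (n j : ℕ) : ℝ := -(-1 : ℝ) ^ n * ((-1 : ℝ) ^ (n - (j+1)) * (n.choose (j+1) : ℝ))

noncomputable def TT (n : ℕ) (d : ℝ) (ψ : ℝ → ℝ) (x : ℝ) : ℝ :=
  ∑ j ∈ Finset.range n, cc n j * AA (((j:ℝ)+1) * d) ψ x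

noncomputable def BB (n : ℕ) : ℝ := ∑ j ∈ Finset.range n, |cc n j|

lemma BB_nonneg (n : ℕ) : 0 ≤ BB n := Finset.sum_nonneg fun _ _ => abs_nonneg _

lemma fdiff_eq (n : ℕ) (h : ℝ) (φ : ℝ → ℝ) (x : ℝ) :
    fdiff n h φ x = (-1 : ℝ)^n * (φ x - ∑ j ∈ Finset.range n, cc n j * φ (x + ((j:ℝ)+1) * h)) := by
  have h1 : (-1 : ℝ)^n * (-1 : ℝ)^n = 1 := by rw [← mul_pow]; norm_num
  unfold fdiff cc
  rw [Finset.sum_range_succ', mul_sub, Finset.mul_sum, sub_eq_add_neg, ← Finset.sum_neg_distrib, add_comm]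
  congr 1
  · simp
  · apply Finset.sum_congr rfl
    intro j _
    push_cast
    linear_combination -((-1 : ℝ) ^ (n - (j+1)) * (n.choose (j+1) : ℝ) * φ (x + ((j:ℝ)+1) * h)) * h1

lemma AA_cont (u : ℝ) {ψ : ℝ → ℝ} (hψ : Continuous ψ) : Continuous (AA u ψ) := by
  unfold AA
  apply intervalIntegral.continuous_parametric_intervalIntegral_of_continuous'
  fun_prop

lemma TT_cont (n : ℕ) (u : ℝ) {ψ : ℝ → ℝ} (hψ : Continuous ψ) : Continuous (TT n u ψ) := by
  unfold TT
  exact continuous_finset_sum _ fun j _ => continuous_const.mul (AA_cont _ hψ)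

lemma AA_bound (u : ℝ) {ψ : ℝ → ℝ} {M : ℝ} (hM : ∀ x, |ψ x| ≤ M) (x : ℝ) : |AA u ψ x| ≤ M := by
  have := intervalIntegral.norm_integral_le_of_norm_le_const (a := (0:ℝ)) (b := 1)
    (f := fun t => ψ (x + u * t)) (C := M) (fun t _ => hM _)
  simpa [AA] using this

lemma TT_bound (n : ℕ) (u : ℝ) {ψ : ℝ → ℝ} {M : ℝ} (hM : ∀ x, |ψ x| ≤ M) (x : ℝ) :
    |TT n u ψ x| ≤ BB n * M := by
  unfold TT BB
  rw [Finset.sum_mul]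
  refine (Finset.abs_sum_le_sum_abs _ _).trans (Finset.sum_le_sum fun j _ => ?_)
  rw [abs_mul]
  exact mul_le_mul_of_nonneg_left (AA_bound _ hM x) (abs_nonneg _)

lemma AA_holder {u d α : ℝ} (hd : 0 < d) (hu : d ≤ u) (hα : 0 < α) (hα1 : α < 1)
    {ψ : ℝ → ℝ} (hψ : Continuous ψ)
    (hM : ∀ x, |ψ x| ≤ 1) (x y : ℝ) : |AA u ψ x - AA u ψ y| ≤ 2 * d ^ (-α) * |x - y| ^ α := by
  have hu0 : 0 < u := hd.trans_le hu
  have key : ∀ z, AA u ψ z = u⁻¹ * ∫ t in z..(z+u), ψ t := by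
    intro z
    unfold AA
    rw [intervalIntegral.integral_comp_add_mul ψ hu0.ne' z]
    simp
  have b1 : |AA u ψ x - AA u ψ y| ≤ 2 := by
    have := AA_bound u hM x
    have := AA_bound u hM y
    calc _ ≤ |AA u ψ x| + |AA u ψ y| := abs_sub _ _
      _ ≤ 2 := by linarith
  have b2 : |AA u ψ x - AA u ψ y| ≤ 2 * (|x - y| / d) := by
    have hi : ∀ p q, IntervalIntegrable ψ volume p q := fun p q => hψ.intervalIntegrable p q
    have e : (∫ t in x..(x+u), ψ t) - (∫ t in y..(y+u), ψ t)
        = (∫ t in x..y, ψ t) - ∫ t in (x+u)..(y+u), ψ t :=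
      intervalIntegral.integral_interval_sub_interval_comm (hi _ _) (hi _ _) (hi _ _)
    have n1 : |∫ t in x..y, ψ t| ≤ |x - y| := by
      have := intervalIntegral.norm_integral_le_of_norm_le_const (a := x) (b := y)
        (f := ψ) (C := 1) (fun t _ => hM _)
      rw [abs_sub_comm]; simpa using this
    have n2 : |∫ t in (x+u)..(y+u), ψ t| ≤ |x - y| := by
      have := intervalIntegral.norm_integral_le_of_norm_le_const (a := x+u) (b := y+u)
        (f := ψ) (C := 1) (fun t _ => hM _)
      rw [abs_sub_comm]; simpa using this
    rw [key, key, ← mul_sub, e, abs_mul, abs_of_pos (inv_pos.2 hu0)]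
    have n3 : |(∫ t in x..y, ψ t) - ∫ t in (x+u)..(y+u), ψ t| ≤ 2 * |x - y| :=
      (abs_sub _ _).trans (by linarith)
    calc _ ≤ d⁻¹ * (2 * |x-y|) := by gcongr
      _ = _ := by ring
  have hr : 0 ≤ |x - y| / d := by positivity
  have b3 : |AA u ψ x - AA u ψ y| ≤ 2 * (|x - y| / d) ^ α := by
    rcases le_total (|x-y|/d) 1 with h | h
    · refine b2.trans ?_
      have := Real.rpow_le_rpow_of_exponent_ge' hr h hα.le hα1.le
      rw [Real.rpow_one] at this
      linarith
    · have := Real.one_le_rpow h hα.le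
      linarith
  rw [Real.div_rpow (abs_nonneg _) hd.le] at b3
  rw [Real.rpow_neg hd.le]
  calc _ ≤ _ := b3
    _ = _ := by ring

lemma TT_holder (n : ℕ) {d α : ℝ} (hd : 0 < d) (hα : 0 < α) (hα1 : α < 1)
    {ψ : ℝ → ℝ} (hψ : Continuous ψ)
    (hM : ∀ x, |ψ x| ≤ 1) (x y : ℝ) :
    |TT n d ψ x - TT n d ψ y| ≤ (BB n * (2 * d ^ (-α))) * |x - y| ^ α := by
  unfold TT BB
  rw [← Finset.sum_sub_distrib, Finset.sum_mul, Finset.sum_mul]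
  refine (Finset.abs_sum_le_sum_abs _ _).trans (Finset.sum_le_sum fun j _ => ?_)
  rw [← mul_sub, abs_mul, mul_assoc]
  refine mul_le_mul_of_nonneg_left (AA_holder hd ?_ hα hα1 hψ hM x y) (abs_nonneg _)
  have : (0:ℝ) ≤ j := Nat.cast_nonneg j
  nlinarith

lemma AA_comm (u v : ℝ) {ψ : ℝ → ℝ} (hψ : Continuous ψ) (x : ℝ) :
    AA u (AA v ψ) x = AA v (AA u ψ) x := by
  unfold AA
  simp only [intervalIntegral.integral_of_le (zero_le_one' ℝ)]
  rw [integral_integral_swap]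
  · simp only [add_right_comm]
  · rw [Measure.prod_restrict]
    refine IntegrableOn.mono_set (t := Set.Icc (0:ℝ) 1 ×ˢ Set.Icc (0:ℝ) 1) ?_
      (Set.prod_mono Set.Ioc_subset_Icc_self Set.Ioc_subset_Icc_self)
    apply ContinuousOn.integrableOn_compact (isCompact_Icc.prod isCompact_Icc)
    apply Continuous.continuousOn
    simp only [Function.uncurry_def]
    fun_prop

lemma AA_TT (n : ℕ) (u d : ℝ) {ψ : ℝ → ℝ} (hψ : Continuous ψ) (x : ℝ) :
    AA u (TT n d ψ) x = ∑ j ∈ Finset.range n, cc n j * AA u (AA (((j:ℝ)+1) * d) ψ) x := by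
  conv_lhs => unfold AA TT
  rw [intervalIntegral.integral_finset_sum]
  · apply Finset.sum_congr rfl
    intro j _
    rw [intervalIntegral.integral_const_mul]
    rfl
  · intro j _
    apply Continuous.intervalIntegrable
    have := AA_cont (((j:ℝ)+1) * d) hψ
    fun_prop

lemma TT_comm (n : ℕ) (d e : ℝ) {ψ : ℝ → ℝ} (hψ : Continuous ψ) (x : ℝ) :
    TT n d (TT n e ψ) x = TT n e (TT n d ψ) x := by
  have key : ∀ d e, TT n d (TT n e ψ) x = ∑ i ∈ Finset.range n, ∑ j ∈ Finset.range n,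
      cc n i * cc n j * AA (((i:ℝ)+1) * d) (AA (((j:ℝ)+1) * e) ψ) x := by
    intro d e
    conv_lhs => unfold TT
    apply Finset.sum_congr rfl
    intro i _
    have := AA_TT n (((i:ℝ)+1) * d) e hψ x
    unfold TT at this
    rw [this, Finset.mul_sum]
    apply Finset.sum_congr rfl
    intro j _
    ring
  rw [key, key, Finset.sum_comm]
  apply Finset.sum_congr rfl
  intro i _
  apply Finset.sum_congr rfl
  intro j _
  rw [AA_comm _ _ hψ]
  ring

lemma int_of_bdd (κ : Measure ℝ) [IsFiniteMeasure κ] {φ : ℝ → ℝ} (hφ : Continuous φ) {M : ℝ}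
    (hM : ∀ x, |φ x| ≤ M) : Integrable φ κ :=
  Integrable.of_bound hφ.aestronglyMeasurable M (Filter.Eventually.of_forall hM)

lemma step1 (κ : Measure ℝ) [IsFiniteMeasure κ] (n : ℕ) (a d E : ℝ) (ha : 0 < a) (hd : 0 ≤ d)
    (hd1 : d ≤ 1) (hE : 0 ≤ E) {φ : ℝ → ℝ} (hφ : Continuous φ) {M : ℝ} (hM : ∀ x, |φ x| ≤ M)
    (H : ∀ h : ℝ, |h| ≤ 1 → |∫ y, fdiff n h φ y ∂κ| ≤ E * |h| ^ a) :
    |∫ y, φ y ∂κ - ∫ y, TT n d φ y ∂κ| ≤ E * d ^ a := by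
  set F : ℝ → ℝ → ℝ := fun y t => φ y - ∑ j ∈ Finset.range n, cc n j * φ (y + ((j:ℝ)+1) * (d * t)) with hF
  have hFc : Continuous (Function.uncurry F) := by
    simp only [hF, Function.uncurry_def]
    fun_prop
  have e1 : ∀ y, φ y - TT n d φ y = ∫ t in Set.Ioc (0:ℝ) 1, F y t := by
    intro y
    rw [← intervalIntegral.integral_of_le zero_le_one]
    simp only [hF]
    rw [intervalIntegral.integral_sub, intervalIntegral.integral_finset_sum]
    · simp [TT, AA, mul_assoc]
    · intro j _
      apply Continuous.intervalIntegrable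
      fun_prop
    · simp
    · apply Continuous.intervalIntegrable
      fun_prop
  rw [← integral_sub (int_of_bdd κ hφ hM) (int_of_bdd κ (TT_cont n d hφ) (TT_bound n d hM))]
  simp_rw [e1]
  rw [integral_integral_swap]
  · rw [← intervalIntegral.integral_of_le zero_le_one]
    have := intervalIntegral.norm_integral_le_of_norm_le_const (a := (0:ℝ)) (b := 1)
      (f := fun t => ∫ y, F y t ∂κ) (C := E * d ^ a) ?_
    · simpa using this
    intro t ht
    rw [Set.uIoc_of_le zero_le_one] at ht
    have hdt : |d * t| = d * t := abs_of_nonneg (mul_nonneg hd ht.1.le)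
    have hdt' : d * t ≤ d := by nlinarith [ht.2]
    have h2 := H (d * t) (by rw [hdt]; linarith)
    simp_rw [fdiff_eq] at h2
    rw [integral_const_mul, abs_mul, abs_pow, abs_neg, abs_one, one_pow, one_mul, hdt] at h2
    refine h2.trans ?_
    have : (d*t)^a ≤ d^a := Real.rpow_le_rpow (mul_nonneg hd ht.1.le) hdt' ha.le
    gcongr
  · refine Integrable.of_bound hFc.aestronglyMeasurable (M + BB n * M) (Filter.Eventually.of_forall ?_)
    rintro ⟨y, t⟩
    simp only [Function.uncurry, hF]
    refine (abs_sub _ _).trans (add_le_add (hM _) ?_)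
    unfold BB
    rw [Finset.sum_mul]
    refine (Finset.abs_sum_le_sum_abs _ _).trans (Finset.sum_le_sum fun j _ => ?_)
    rw [abs_mul]
    exact mul_le_mul_of_nonneg_left (hM _) (abs_nonneg _)

lemma TT_tendsto (κ : Measure ℝ) [IsFiniteMeasure κ] (n : ℕ) (hn : 1 ≤ n) {ψ : ℝ → ℝ}
    (hψ : Continuous ψ) (hM : ∀ x, |ψ x| ≤ 1) :
    Filter.Tendsto (fun k : ℕ => ∫ y, TT n ((1/2)^k) ψ y ∂κ) Filter.atTop (nhds (∫ y, ψ y ∂κ)) := by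
  have hsum : ∑ j ∈ Finset.range n, cc n j = 1 := by
    have h := fdiff_eq n 0 (fun _ => 1) 0
    have h0 : fdiff n 0 (fun _ => 1) 0 = 0 := by
      have := add_pow (1:ℝ) (-1) n
      rw [add_neg_cancel, zero_pow (by omega)] at this
      unfold fdiff
      rw [this]
      apply Finset.sum_congr rfl
      intro j _
      simp
    rw [h0] at h
    have h1 : ((-1:ℝ))^n ≠ 0 := pow_ne_zero _ (by norm_num)
    have := (mul_eq_zero.1 h.symm).resolve_left h1
    simp only [mul_one] at this
    linarith
  refine tendsto_integral_of_dominated_convergence (fun _ => BB n * 1)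
    (fun k => (TT_cont n _ hψ).aestronglyMeasurable) (integrable_const _)
    (fun k => Filter.Eventually.of_forall (TT_bound n _ hM)) (Filter.Eventually.of_forall fun y => ?_)
  have hc : Continuous fun d => TT n d ψ y := by
    unfold TT AA
    refine continuous_finset_sum _ fun j _ => continuous_const.mul ?_
    apply intervalIntegral.continuous_parametric_intervalIntegral_of_continuous'
    fun_prop
  have h0 : TT n 0 ψ y = ψ y := by
    simp [TT, AA, ← Finset.sum_mul, hsum]
  have := (hc.tendsto 0).comp (tendsto_pow_atTop_nhds_zero_of_lt_one (r := (1/2:ℝ)) (by norm_num) (by norm_num))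
  rw [h0] at this
  exact this

lemma TT_null (κ : Measure ℝ) [IsFiniteMeasure κ] (n : ℕ) {d : ℝ} (hd : 0 < d) {ψ : ℕ → ℝ → ℝ}
    (hψ : ∀ m, Continuous (ψ m)) (hM : ∀ m x, |ψ m x| ≤ 1) {S : Set ℝ} (hS : volume S = 0)
    (hlim : ∀ x ∉ S, Filter.Tendsto (fun m => ψ m x) Filter.atTop (nhds 0)) :
    Filter.Tendsto (fun m : ℕ => ∫ y, TT n d (ψ m) y ∂κ) Filter.atTop (nhds 0) := by
  rw [← integral_zero ℝ ℝ (μ := κ)]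
  refine tendsto_integral_of_dominated_convergence (fun _ => BB n * 1)
    (fun k => (TT_cont n _ (hψ k)).aestronglyMeasurable) (integrable_const _)
    (fun k => Filter.Eventually.of_forall (TT_bound n _ (hM k))) (Filter.Eventually.of_forall fun y => ?_)
  unfold TT
  rw [← Finset.sum_const_zero (s := Finset.range n)]
  refine tendsto_finset_sum _ fun j _ => ?_
  rw [← mul_zero (cc n j)]
  refine Filter.Tendsto.const_mul _ ?_
  set u := ((j:ℝ)+1) * d with hu
  have hu0 : 0 < u := by positivity
  have key : ∀ m, AA u (ψ m) y = u⁻¹ * ∫ t in y..(y+u), ψ m t := by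
    intro z
    unfold AA
    rw [intervalIntegral.integral_comp_add_mul (ψ z) hu0.ne' y]
    simp
  simp_rw [key]
  rw [← mul_zero u⁻¹]
  refine Filter.Tendsto.const_mul _ ?_
  rw [← intervalIntegral.integral_zero (a := y) (b := y+u) (E := ℝ) (μ := volume)]
  refine intervalIntegral.tendsto_integral_filter_of_dominated_convergence (fun _ => 1)
    (Filter.Eventually.of_forall fun m => (hψ m).aestronglyMeasurable)
    (Filter.Eventually.of_forall fun m => Filter.Eventually.of_forall fun x _ => hM m x)
    (by simp) ?_
  have : ∀ᵐ x, x ∉ S := measure_eq_zero_iff_ae_notMem.1 hS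
  filter_upwards [this] with x hx _
  exact hlim x hx

/-- the Debussche–Romito criterion for absolute continuity of a finite measure. -/
theorem statement0 (κ : Measure ℝ) [IsFiniteMeasure κ]
    (α a : ℝ) (n : ℕ) (C : ℝ)
    (hα : 0 < α) (hαa : α < a) (ha : a < 1) (hn : 1 ≤ n) (hna : a < (n : ℝ)) (hC : 0 < C)
    (H : ∀ φ : ℝ → ℝ, ∀ M K : ℝ,
      (∀ x, |φ x| ≤ M) →
      (∀ x y, |φ x - φ y| ≤ K * |x - y| ^ α) →
      ∀ h : ℝ, |h| ≤ 1 →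
        |∫ y, fdiff n h φ y ∂κ| ≤ C * (M + K) * |h| ^ a) :
    κ.AbsolutelyContinuous volume := by
  have hα1 : α < 1 := hαa.trans ha
  have ha0 : 0 < a := hα.trans hαa
  set r : ℝ := (1/2:ℝ) ^ (a - α) with hr
  have hr0 : 0 < r := by positivity
  have hr1 : r < 1 := Real.rpow_lt_one (by norm_num) (by norm_num) (by linarith)
  set D : ℝ := 9 * C * BB n with hD
  have hB := BB_nonneg n
  -- one smoothing step
  have s1 : ∀ ψ : ℝ → ℝ, Continuous ψ → (∀ x, |ψ x| ≤ 1) → ∀ d e : ℝ, 0 < d → d ≤ 1 → 0 < e → e ≤ 1 →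
      |∫ y, TT n d ψ y ∂κ - ∫ y, TT n e (TT n d ψ) y ∂κ| ≤ 3 * C * BB n * d ^ (-α) * e ^ a := by
    intro ψ hψ hM d e hd hd1 he he1
    have h1 : 1 ≤ d ^ (-α) := Real.one_le_rpow_of_pos_of_le_one_of_nonpos hd hd1 (by linarith)
    refine step1 κ n a e _ ha0 he.le he1 (by positivity) (TT_cont n d hψ) (TT_bound n d hM) ?_
    intro h hh
    refine (H _ _ _ (TT_bound n d hM) (TT_holder n hd hα hα1 hψ hM) h hh).trans ?_
    refine mul_le_mul_of_nonneg_right ?_ (by positivity)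
    have : BB n * 1 ≤ BB n * d ^ (-α) := by gcongr
    nlinarith
  have s2 : ∀ ψ : ℝ → ℝ, Continuous ψ → (∀ x, |ψ x| ≤ 1) → ∀ k : ℕ,
      dist (∫ y, TT n ((1/2)^k) ψ y ∂κ) (∫ y, TT n ((1/2)^(k+1)) ψ y ∂κ) ≤ D * r ^ k := by
    intro ψ hψ hM k
    set d : ℝ := (1/2)^k with hd
    have hd0 : 0 < d := by positivity
    have hd1 : d ≤ 1 := pow_le_one₀ (by norm_num) (by norm_num)
    have he : (1/2:ℝ)^(k+1) = d * (1/2) := pow_succ _ _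
    rw [he]
    set e : ℝ := d * (1/2) with he'
    have he0 : 0 < e := by positivity
    have he1 : e ≤ 1 := by linarith
    have p1 := s1 ψ hψ hM d e hd0 hd1 he0 he1
    have p2 := s1 ψ hψ hM e d he0 he1 hd0 hd1
    have hc : ∫ y, TT n e (TT n d ψ) y ∂κ = ∫ y, TT n d (TT n e ψ) y ∂κ :=
      integral_congr_ae (Filter.Eventually.of_forall fun y => TT_comm n e d hψ y)
    rw [hc] at p1
    have hrk : r ^ k = d ^ (-α) * d ^ a := by
      rw [← Real.rpow_add hd0, hr, hd, ← Real.rpow_natCast, ← Real.rpow_natCast,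
        ← Real.rpow_mul (by norm_num), ← Real.rpow_mul (by norm_num)]
      congr 1; ring
    have q1 : e ^ a ≤ d ^ a := Real.rpow_le_rpow he0.le (by linarith) ha0.le
    have q2 : e ^ (-α) ≤ 2 * d ^ (-α) := by
      rw [he', Real.mul_rpow hd0.le (by norm_num), mul_comm]
      refine mul_le_mul_of_nonneg_right ?_ (by positivity)
      rw [one_div, Real.inv_rpow (by norm_num), Real.rpow_neg (by norm_num), inv_inv]
      calc (2:ℝ)^α ≤ 2^(1:ℝ) := Real.rpow_le_rpow_of_exponent_le (by norm_num) hα1.le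
        _ = 2 := Real.rpow_one _
    have p1' : 3 * C * BB n * d ^ (-α) * e ^ a ≤ 3 * C * BB n * d ^ (-α) * d ^ a := by gcongr
    have p2' : 3 * C * BB n * e ^ (-α) * d ^ a ≤ 3 * C * BB n * (2 * d ^ (-α)) * d ^ a := by gcongr
    rw [Real.dist_eq, hrk, hD]
    rw [abs_le] at *
    constructor <;> nlinarith
  have s3 : ∀ ψ : ℝ → ℝ, Continuous ψ → (∀ x, |ψ x| ≤ 1) → ∀ k : ℕ,
      ∫ y, ψ y ∂κ ≤ ∫ y, TT n ((1/2)^k) ψ y ∂κ + D * r ^ k / (1 - r) := by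
    intro ψ hψ hM k
    have := dist_le_of_le_geometric_of_tendsto r D hr1 (s2 ψ hψ hM) (TT_tendsto κ n hn hψ hM) k
    rw [Real.dist_eq, abs_le] at this
    linarith
  have s4 : ∀ S : Set ℝ, IsCompact S → volume S = 0 → κ S = 0 := by
    intro S hS hS0
    have hδ : ∀ m : ℕ, (0:ℝ) < 1 / ((m:ℝ)+1) := fun m => Nat.one_div_pos_of_nat
    have hδl : Filter.Tendsto (fun m : ℕ => 1 / ((m:ℝ)+1)) Filter.atTop (nhds 0) :=
      tendsto_one_div_add_atTop_nhds_zero_nat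
    set ψ : ℕ → ℝ → ℝ := fun m x => (thickenedIndicator (hδ m) S x : ℝ) with hψd
    have hψ : ∀ m, Continuous (ψ m) := fun m =>
      NNReal.continuous_coe.comp (thickenedIndicator (hδ m) S).continuous
    have hM : ∀ m x, |ψ m x| ≤ 1 := by
      intro m x
      rw [abs_of_nonneg (NNReal.coe_nonneg _)]
      exact_mod_cast thickenedIndicator_le_one (hδ m) S x
    have hlim : ∀ x ∉ S, Filter.Tendsto (fun m => ψ m x) Filter.atTop (nhds 0) := by
      intro x hx
      have h := tendsto_pi_nhds.1 (thickenedIndicator_tendsto_indicator_closure hδ hδl S) x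
      rw [hS.isClosed.closure_eq, Set.indicator_of_notMem hx] at h
      exact NNReal.tendsto_coe.2 h
    have hle : ∀ m, κ.real S ≤ ∫ y, ψ m y ∂κ := by
      intro m
      rw [← integral_indicator_one hS.measurableSet]
      refine integral_mono ?_ (int_of_bdd κ (hψ m) (hM m)) ?_
      · exact (integrable_const (1:ℝ)).indicator hS.measurableSet
      · intro x
        by_cases hx : x ∈ S
        · have h1 : ψ m x = 1 := by
            simp only [hψd]
            rw [thickenedIndicator_one (hδ m) S hx, NNReal.coe_one]
          rw [h1, Set.indicator_of_mem hx, Pi.one_apply]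
        · simp [hx, hψd]
    have hk : ∀ k : ℕ, κ.real S ≤ D * r ^ k / (1 - r) := by
      intro k
      have ht := (TT_null κ n (d := (1/2)^k) (by positivity) hψ hM hS0 hlim).add_const (D * r ^ k / (1 - r))
      rw [zero_add] at ht
      exact ge_of_tendsto' ht fun m => (hle m).trans (s3 _ (hψ m) (hM m) k)
    have hz : Filter.Tendsto (fun k : ℕ => D * r ^ k / (1 - r)) Filter.atTop (nhds 0) := by
      have := ((tendsto_pow_atTop_nhds_zero_of_lt_one hr0.le hr1).const_mul D).div_const (1 - r)
      simpa using this
    have h0 : κ.real S ≤ 0 := ge_of_tendsto' hz hk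
    have h1 : κ.real S = 0 := le_antisymm h0 measureReal_nonneg
    exact (measureReal_eq_zero_iff).1 h1
  refine Measure.AbsolutelyContinuous.mk fun s hs hs0 => ?_
  rw [hs.measure_eq_iSup_isCompact]
  simp only [ENNReal.iSup_eq_zero]
  intro K hKs hK
  exact s4 K hK (measure_mono_null hKs hs0)
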